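/- Assume λ‖W‖_∞ < 1, 1/(1−λ‖W‖_∞) ≤ L and λ/(1−λ‖W‖_∞) + 1 ≤ L. The map g ↦ s_g, where s_g(t) = g(t) + λ ∫₀¹ Γ(t,s,λ) g(s) ds, is injective as a map on L¹-equivalence classes: if g₁, g₂ : [0,1] → [0,1] are measurable and differ on a set of positive Lebesgue measure, then s_{g₁} and s_{g₂} differ on a set of positive Lebesgue measure (and hence are distinct Nash equilibria). -/

import Mathlib

open MeasureTheory Set Filter Topology

/-- The iterated kernels: `iterKernel W 0 = W₁ = W` and
`iterKernel W n t s = W_{n+1}(t,s) = ∫₀¹ W(t,x) · W_n(x,s) dx`. -/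
noncomputable def iterKernel (W : ℝ → ℝ → ℝ) : ℕ → ℝ → ℝ → ℝ
  | 0 => W
  | n + 1 => fun t s => ∫ x in Set.Icc (0 : ℝ) 1, W t x * iterKernel W n x s

/-- `Γ(t,s,λ) = Σ_{n=1}^∞ λ^{n-1} W_n(t,s)`. -/
noncomputable def GammaKernel (W : ℝ → ℝ → ℝ) (lam t s : ℝ) : ℝ :=
  ∑' n : ℕ, lam ^ n * iterKernel W n t s

/-- `s_g(t) = g(t) + λ ∫₀¹ Γ(t,s,λ) g(s) ds`. -/
noncomputable def sgProfile (W : ℝ → ℝ → ℝ) (lam : ℝ) (g : ℝ → ℝ) (t : ℝ) : ℝ :=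
  g t + lam * ∫ s in Set.Icc (0 : ℝ) 1, GammaKernel W lam t s * g s

section BoundedKernel

variable {W : ℝ → ℝ → ℝ} {M lam : ℝ}

theorem measurable_iterKernel (hW : Measurable (Function.uncurry W)) (n : ℕ) :
    Measurable (Function.uncurry (iterKernel W n)) := by
  induction n with
  | zero => exact hW
  | succ n ih =>
    have h : Measurable (fun q : (ℝ × ℝ) × ℝ => W q.1.1 q.2 * iterKernel W n q.2 q.1.2) :=
      (hW.comp (by fun_prop : Measurable fun q : (ℝ × ℝ) × ℝ => (q.1.1, q.2))).mul
        (ih.comp (by fun_prop : Measurable fun q : (ℝ × ℝ) × ℝ => (q.2, q.1.2)))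
    exact (h.stronglyMeasurable.integral_prod_right
      (ν := volume.restrict (Set.Icc (0 : ℝ) 1))).measurable

theorem norm_iterKernel_le (hM : ∀ t s, ‖W t s‖ ≤ M) (n : ℕ) (t s : ℝ) :
    ‖iterKernel W n t s‖ ≤ M ^ (n + 1) := by
  induction n generalizing t s with
  | zero => simpa [iterKernel] using hM t s
  | succ n ih =>
    have hM0 : 0 ≤ M := (norm_nonneg _).trans (hM 0 0)
    have h : ∀ x, ‖W t x * iterKernel W n x s‖ ≤ M ^ (n + 1 + 1) := fun x => by
      rw [norm_mul, pow_succ' M (n + 1)]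
      exact mul_le_mul (hM t x) (ih x s) (norm_nonneg _) hM0
    have := norm_integral_le_of_norm_le_const (μ := volume.restrict (Set.Icc (0 : ℝ) 1))
      (ae_of_all _ h)
    simpa [iterKernel] using this

theorem norm_pow_mul_iterKernel_le (hM : ∀ t s, ‖W t s‖ ≤ M) (hlam : 0 ≤ lam) (n : ℕ)
    (t s : ℝ) : ‖lam ^ n * iterKernel W n t s‖ ≤ M * (lam * M) ^ n := by
  rw [norm_mul, norm_pow, Real.norm_of_nonneg hlam]
  calc lam ^ n * ‖iterKernel W n t s‖ ≤ lam ^ n * M ^ (n + 1) := by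
        gcongr; exact norm_iterKernel_le hM n t s
    _ = M * (lam * M) ^ n := by ring

theorem summable_mul_geometric (hM : ∀ t s, ‖W t s‖ ≤ M) (hlam : 0 ≤ lam)
    (hlamM : lam * M < 1) : Summable fun n : ℕ => M * (lam * M) ^ n :=
  (summable_geometric_of_lt_one
    (mul_nonneg hlam ((norm_nonneg _).trans (hM 0 0))) hlamM).mul_left M

theorem summable_gammaKernel (hM : ∀ t s, ‖W t s‖ ≤ M) (hlam : 0 ≤ lam)
    (hlamM : lam * M < 1) (t s : ℝ) : Summable fun n : ℕ => lam ^ n * iterKernel W n t s :=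
  (summable_mul_geometric hM hlam hlamM).of_norm_bounded
    fun n => norm_pow_mul_iterKernel_le hM hlam n t s

theorem norm_gammaKernel_le (hM : ∀ t s, ‖W t s‖ ≤ M) (hlam : 0 ≤ lam)
    (hlamM : lam * M < 1) (t s : ℝ) :
    ‖GammaKernel W lam t s‖ ≤ ∑' n : ℕ, M * (lam * M) ^ n :=
  tsum_of_norm_bounded (summable_mul_geometric hM hlam hlamM).hasSum
    fun n => norm_pow_mul_iterKernel_le hM hlam n t s

theorem measurable_gammaKernel (hW : Measurable (Function.uncurry W))
    (hM : ∀ t s, ‖W t s‖ ≤ M) (hlam : 0 ≤ lam) (hlamM : lam * M < 1) :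
    Measurable (Function.uncurry (GammaKernel W lam)) := by
  refine measurable_of_tendsto_metrizable
    (f := fun N p => ∑ n ∈ Finset.range N, lam ^ n * iterKernel W n p.1 p.2) (fun N => ?_)
    (tendsto_pi_nhds.2 fun p =>
      (summable_gammaKernel hM hlam hlamM p.1 p.2).hasSum.tendsto_sum_nat)
  exact Finset.measurable_sum _ fun n _ => (measurable_iterKernel hW n).const_mul _

/-- The resolvent equation `Γ = W + λ W ∘ Γ`. -/
theorem gammaKernel_eq (hW : Measurable (Function.uncurry W))
    (hM : ∀ t s, ‖W t s‖ ≤ M) (hlam : 0 ≤ lam) (hlamM : lam * M < 1) (t s : ℝ) :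
    GammaKernel W lam t s =
      W t s + lam * ∫ x in Set.Icc (0 : ℝ) 1, W t x * GammaKernel W lam x s := by
  have hM0 : 0 ≤ M := (norm_nonneg _).trans (hM 0 0)
  have hb : ∀ n x, ‖W t x * (lam ^ n * iterKernel W n x s)‖ ≤ M * (M * (lam * M) ^ n) :=
    fun n x => by
      rw [norm_mul]
      exact mul_le_mul (hM t x) (norm_pow_mul_iterKernel_le hM hlam n x s) (norm_nonneg _) hM0
  have hsum : HasSum
      (fun n : ℕ => ∫ x in Set.Icc (0 : ℝ) 1, W t x * (lam ^ n * iterKernel W n x s))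
      (∫ x in Set.Icc (0 : ℝ) 1, W t x * GammaKernel W lam x s) := by
    refine hasSum_integral_of_dominated_convergence
      (fun n _ => M * (M * (lam * M) ^ n)) (fun n => ?_) (fun n => ae_of_all _ (hb n))
      (ae_of_all _ fun _ => (summable_mul_geometric hM hlam hlamM).mul_left M)
      (integrable_const _)
      (ae_of_all _ fun x => (summable_gammaKernel hM hlam hlamM x s).hasSum.mul_left (W t x))
    exact ((hW.comp measurable_prodMk_left).mul
      (((measurable_iterKernel hW n).comp measurable_prodMk_right).const_mul _)).aestronglyMeasurable
  rw [← hsum.tsum_eq, GammaKernel, (summable_gammaKernel hM hlam hlamM t s).tsum_eq_zero_add,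
    ← tsum_mul_left]
  congr 1
  · simp [iterKernel]
  · refine tsum_congr fun n => ?_
    simp only [iterKernel, ← integral_const_mul]
    refine integral_congr_ae (ae_of_all _ fun x => ?_)
    ring

/-- Applying `W` to `s_f` recovers the `Γ`-part of `s_f`. -/
theorem integral_mul_sgProfile (hW : Measurable (Function.uncurry W))
    (hM : ∀ t s, ‖W t s‖ ≤ M) (hlam : 0 ≤ lam) (hlamM : lam * M < 1) {f : ℝ → ℝ}
    (hf : Integrable f (volume.restrict (Set.Icc (0 : ℝ) 1))) (t : ℝ) :
    ∫ x in Set.Icc (0 : ℝ) 1, W t x * sgProfile W lam f x =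
      ∫ s in Set.Icc (0 : ℝ) 1, GammaKernel W lam t s * f s := by
  set μ : Measure ℝ := volume.restrict (Set.Icc (0 : ℝ) 1)
  have hM0 : 0 ≤ M := (norm_nonneg _).trans (hM 0 0)
  have hΓ := measurable_gammaKernel hW hM hlam hlamM
  have hΓle := norm_gammaKernel_le hM hlam hlamM
  have hWt : Measurable (W t) := hW.comp measurable_prodMk_left
  have hWf : Integrable (fun x => W t x * f x) μ :=
    hf.bdd_mul hWt.aestronglyMeasurable (ae_of_all _ (hM t))
  have hF : Integrable (fun p : ℝ × ℝ => (W t p.1 * GammaKernel W lam p.1 p.2) * f p.2)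
      (μ.prod μ) := by
    refine (hf.comp_snd μ).bdd_mul (c := M * ∑' n : ℕ, M * (lam * M) ^ n)
      ((hWt.comp measurable_fst).mul hΓ).aestronglyMeasurable (ae_of_all _ fun p => ?_)
    rw [norm_mul]
    exact mul_le_mul (hM t p.1) (hΓle p.1 p.2) (norm_nonneg _) hM0
  have hl : ∀ x, W t x * sgProfile W lam f x =
      W t x * f x + lam * ∫ s, (W t x * GammaKernel W lam x s) * f s ∂μ := fun x => by
    simp only [sgProfile, mul_assoc, integral_const_mul]
    ring
  have hr : ∀ s, GammaKernel W lam t s * f s =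
      W t s * f s + lam * ∫ x, (W t x * GammaKernel W lam x s) * f s ∂μ := fun s => by
    rw [gammaKernel_eq hW hM hlam hlamM t s, integral_mul_const]
    ring
  simp only [hl, hr]
  rw [integral_add hWf (hF.integral_prod_left.const_mul lam),
    integral_add hWf (hF.integral_prod_right.const_mul lam), integral_const_mul,
    integral_const_mul, integral_integral_swap hF]

theorem ae_eq_of_sgProfile_ae_eq (hW : Measurable (Function.uncurry W))
    (hM : ∀ t s, ‖W t s‖ ≤ M) (hlam : 0 ≤ lam) (hlamM : lam * M < 1) {f g : ℝ → ℝ}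
    (hf : Integrable f (volume.restrict (Set.Icc (0 : ℝ) 1)))
    (hg : Integrable g (volume.restrict (Set.Icc (0 : ℝ) 1)))
    (h : sgProfile W lam f =ᵐ[volume.restrict (Set.Icc (0 : ℝ) 1)] sgProfile W lam g) :
    f =ᵐ[volume.restrict (Set.Icc (0 : ℝ) 1)] g := by
  filter_upwards [h] with t ht
  have hint : ∫ s in Set.Icc (0 : ℝ) 1, GammaKernel W lam t s * f s =
      ∫ s in Set.Icc (0 : ℝ) 1, GammaKernel W lam t s * g s := by
    rw [← integral_mul_sgProfile hW hM hlam hlamM hf,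
      ← integral_mul_sgProfile hW hM hlam hlamM hg]
    refine integral_congr_ae ?_
    filter_upwards [h] with x hx
    rw [hx]
  simpa [sgProfile, hint] using ht

end BoundedKernel

section Congruence

variable {V W : ℝ → ℝ → ℝ}

theorem iterKernel_congr
    (h : ∀ t ∈ Set.Icc (0 : ℝ) 1, ∀ s ∈ Set.Icc (0 : ℝ) 1, V t s = W t s) (n : ℕ) :
    ∀ t ∈ Set.Icc (0 : ℝ) 1, ∀ s ∈ Set.Icc (0 : ℝ) 1,
      iterKernel V n t s = iterKernel W n t s := by
  induction n with
  | zero => exact h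
  | succ n ih =>
    intro t ht s hs
    refine setIntegral_congr_fun measurableSet_Icc fun x hx => ?_
    simp only [h t ht x hx, ih x hx s hs]

theorem sgProfile_congr
    (h : ∀ t ∈ Set.Icc (0 : ℝ) 1, ∀ s ∈ Set.Icc (0 : ℝ) 1, V t s = W t s)
    (lam : ℝ) (g : ℝ → ℝ) {t : ℝ} (ht : t ∈ Set.Icc (0 : ℝ) 1) :
    sgProfile V lam g t = sgProfile W lam g t := by
  unfold sgProfile
  congr 2
  refine setIntegral_congr_fun measurableSet_Icc fun s hs => ?_
  simp only [GammaKernel, iterKernel_congr h _ t ht s hs]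

end Congruence

theorem integrable_of_mem_Icc {g : ℝ → ℝ} (hg : Measurable g)
    (hg01 : ∀ t ∈ Set.Icc (0 : ℝ) 1, g t ∈ Set.Icc (0 : ℝ) 1) :
    Integrable g (volume.restrict (Set.Icc (0 : ℝ) 1)) := by
  refine Integrable.of_bound hg.aestronglyMeasurable 1 ?_
  filter_upwards [ae_restrict_mem measurableSet_Icc] with t ht
  rw [Real.norm_of_nonneg (hg01 t ht).1]
  exact (hg01 t ht).2

/-- **Proposition 1, second part.** Under the conditions `λ‖W‖_∞ < 1`,
`1/(1-λ‖W‖_∞) ≤ L` and `λ/(1-λ‖W‖_∞) + 1 ≤ L`, the map `g ↦ s_g` is injective on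
L¹-equivalence classes: if `g₁` and `g₂` differ on a set of positive Lebesgue measure
(in `[0,1]`), then so do `s_{g₁}` and `s_{g₂}`. -/
theorem sg_injective
    (W : ℝ → ℝ → ℝ) (hWmeas : Measurable (Function.uncurry W))
    (hW01 : ∀ t ∈ Set.Icc (0 : ℝ) 1, ∀ s ∈ Set.Icc (0 : ℝ) 1, W t s ∈ Set.Icc (0 : ℝ) 1)
    (lam : ℝ) (hlam : 0 ≤ lam) (L : ℝ) (hL : 0 < L)
    (M : ℝ)
    (hM : M = essSup (fun p : ℝ × ℝ => W p.1 p.2)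
      (volume.restrict ((Set.Icc (0 : ℝ) 1) ×ˢ (Set.Icc (0 : ℝ) 1))))
    (hWleM : ∀ t ∈ Set.Icc (0 : ℝ) 1, ∀ s ∈ Set.Icc (0 : ℝ) 1, W t s ≤ M)
    (hlamM : lam * M < 1)
    (hL1 : 1 / (1 - lam * M) ≤ L)
    (hL2 : lam / (1 - lam * M) + 1 ≤ L)
    (g₁ g₂ : ℝ → ℝ) (hg₁ : Measurable g₁) (hg₂ : Measurable g₂)
    (hg₁01 : ∀ t ∈ Set.Icc (0 : ℝ) 1, g₁ t ∈ Set.Icc (0 : ℝ) 1)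
    (hg₂01 : ∀ t ∈ Set.Icc (0 : ℝ) 1, g₂ t ∈ Set.Icc (0 : ℝ) 1)
    (hdiff : (volume.restrict (Set.Icc (0 : ℝ) 1)) {t : ℝ | g₁ t ≠ g₂ t} ≠ 0) :
    (volume.restrict (Set.Icc (0 : ℝ) 1))
      {t : ℝ | sgProfile W lam g₁ t ≠ sgProfile W lam g₂ t} ≠ 0 := by
  intro hs
  refine hdiff ?_
  set V : ℝ → ℝ → ℝ := fun t s =>
    (Set.Icc (0 : ℝ) 1 ×ˢ Set.Icc (0 : ℝ) 1).indicator (Function.uncurry W) (t, s) with hV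
  have hVmeas : Measurable (Function.uncurry V) :=
    hWmeas.indicator (measurableSet_Icc.prod measurableSet_Icc)
  have h0 : (0 : ℝ) ∈ Set.Icc (0 : ℝ) 1 := by simp
  have hM0 : 0 ≤ M := (hW01 0 h0 0 h0).1.trans (hWleM 0 h0 0 h0)
  have hVM : ∀ t s, ‖V t s‖ ≤ M := by
    intro t s
    by_cases h : (t, s) ∈ Set.Icc (0 : ℝ) 1 ×ˢ Set.Icc (0 : ℝ) 1
    · rw [hV]
      simp only [Set.indicator_of_mem h, Function.uncurry_apply_pair]
      rw [Real.norm_of_nonneg (hW01 t h.1 s h.2).1]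
      exact hWleM t h.1 s h.2
    · rw [hV]
      simpa only [Set.indicator_of_notMem h, norm_zero] using hM0
  have hVW : ∀ t ∈ Set.Icc (0 : ℝ) 1, ∀ s ∈ Set.Icc (0 : ℝ) 1, V t s = W t s :=
    fun t ht s hs => Set.indicator_of_mem (Set.mk_mem_prod ht hs) _
  have hae : sgProfile W lam g₁ =ᵐ[volume.restrict (Set.Icc (0 : ℝ) 1)] sgProfile W lam g₂ :=
    ae_iff.2 hs
  refine ae_iff.1 (ae_eq_of_sgProfile_ae_eq hVmeas hVM hlam hlamM
    (integrable_of_mem_Icc hg₁ hg₁01) (integrable_of_mem_Icc hg₂ hg₂01) ?_)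
  filter_upwards [hae, ae_restrict_mem measurableSet_Icc] with t ht htI
  rw [sgProfile_congr hVW lam g₁ htI, sgProfile_congr hVW lam g₂ htI, ht]
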